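/- Let (E, 𝓛, 𝓑) be a weakly left-resolving labeled space and let {p_A : A ∈ 𝓑}, {s_a : a ∈ 𝒜} be a representation of (E, 𝓛, 𝓑) in a C*-algebra. Let α, β, μ, ν ∈ 𝓛^#(E) and A, B ∈ 𝓑. If β = μγ for some nonempty word γ ∈ 𝓛*(E), then (s_α p_A s_β*)(s_μ p_B s_ν*) = s_α p_{A ∩ r(β) ∩ r(B,γ)} s_{νγ}*. If β = μ and β is nonempty, then (s_α p_A s_β*)(s_μ p_B s_ν*) = s_α p_{A ∩ r(β) ∩ B} s_ν*, and if β = μ = ε then the product equals s_α p_{A ∩ B} s_ν*. If neither of β, μ is an initial segment of the other, the product is 0. -/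

import Mathlib

universe u v w

/-- A labeled graph: a directed graph with source and range maps together with a
labeling of the edges by an alphabet `Λ` (onto, i.e. `Λ = 𝓛(E¹)`). -/
structure LabeledGraph (V : Type u) (E : Type v) (Λ : Type w) where
  src : E → V
  rng : E → V
  lab : E → Λ
  lab_surj : Function.Surjective lab

namespace LabeledGraph

variable {V : Type u} {E : Type v} {Λ : Type w} (G : LabeledGraph V E Λ)

/-- A (finite, nonempty) path: a nonempty list of composable edges. -/
def IsPath (p : List E) : Prop :=
  p ≠ [] ∧ p.Chain' (fun e f => G.rng e = G.src f)

/-- The relative range `r(A, α)`. -/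
def relRange (A : Set V) (α : List Λ) : Set V :=
  {v | ∃ p : List E, G.IsPath p ∧ p.map G.lab = α ∧
      (∃ e, p.head? = some e ∧ G.src e ∈ A) ∧
      (∃ e, p.getLast? = some e ∧ G.rng e = v)}

/-- The range `r(α) = r(E⁰, α)`. -/
def range (α : List Λ) : Set V := G.relRange Set.univ α

/-- The source set `s(α)` of a word. -/
def srcSet (α : List Λ) : Set V :=
  {v | ∃ p : List E, G.IsPath p ∧ p.map G.lab = α ∧
      (∃ e, p.head? = some e ∧ G.src e = v)}

/-- `𝓛(A E¹)`: the labels of edges with source in `A`. -/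
def labelSet (A : Set V) : Set Λ :=
  {a | ∃ e, G.src e ∈ A ∧ G.lab e = a}

/-- `𝓛*(E)`: the labels of finite nonempty paths. -/
def words : Set (List Λ) :=
  {α | ∃ p : List E, G.IsPath p ∧ p.map G.lab = α}

/-- `𝓛^#(E) = 𝓛*(E) ∪ {ε}`. -/
def wordsHash : Set (List Λ) := insert [] G.words

/-- The set of sinks `E⁰_sink`. -/
def sinks : Set V := {v | ∀ e : E, G.src e ≠ v}

/-- `ℬ ⊆ 2^{E⁰}` is accommodating. -/
structure Accommodating (ℬ : Set (Set V)) : Prop where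
  nonempty : ∃ A ∈ ℬ, A ≠ ∅
  range_mem : ∀ α ∈ G.words, G.range α ∈ ℬ
  relRange_mem : ∀ A ∈ ℬ, ∀ α ∈ G.words, G.relRange A α ∈ ℬ
  inter_mem : ∀ A ∈ ℬ, ∀ B ∈ ℬ, A ∩ B ∈ ℬ
  union_mem : ∀ A ∈ ℬ, ∀ B ∈ ℬ, A ∪ B ∈ ℬ

/-- `(E, 𝓛, ℬ)` is weakly left-resolving. -/
def WeaklyLeftResolving (ℬ : Set (Set V)) : Prop :=
  ∀ A ∈ ℬ, ∀ B ∈ ℬ, ∀ α ∈ G.words,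
    G.relRange (A ∩ B) α = G.relRange A α ∩ G.relRange B α

/-- `ℬ` is closed under relative complements (non-degeneracy). -/
def NonDegenerate (_G : LabeledGraph V E Λ) (ℬ : Set (Set V)) : Prop :=
  ∀ A ∈ ℬ, ∀ B ∈ ℬ, A \ B ∈ ℬ

/-- A hereditary subset `ℋ` of `ℬ` (not containing `∅`). -/
structure Hereditary (ℬ ℋ : Set (Set V)) : Prop where
  subset : ℋ ⊆ ℬ
  empty_not_mem : ∅ ∉ ℋ
  relRange_mem : ∀ A ∈ ℋ, ∀ α ∈ G.words, G.relRange A α ≠ ∅ → G.relRange A α ∈ ℋ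
  union_mem : ∀ A ∈ ℋ, ∀ B ∈ ℋ, A ∪ B ∈ ℋ
  mem_of_subset : ∀ A ∈ ℋ, ∀ B ∈ ℬ, B ≠ ∅ → B ⊆ A → B ∈ ℋ

/-- A minimal sinks set. -/
def MinimalSinksSet (ℬ : Set (Set V)) (A : Set V) : Prop :=
  A ∈ ℬ ∧ A.Nonempty ∧ A ⊆ G.sinks ∧ ∀ B ∈ ℬ, A ⊆ B ∨ A ∩ B = ∅

end LabeledGraph

/-- A representation of the labeled space `(E, 𝓛, ℬ)` in a C*-algebra `B`. -/
structure LabeledSpaceRep {V : Type u} {E : Type v} {Λ : Type w}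
    (G : LabeledGraph V E Λ) (ℬ : Set (Set V))
    (B : Type*) [CStarAlgebra B] where
  p : Set V → B
  s : Λ → B
  p_empty : p ∅ = 0
  p_selfAdjoint : ∀ A ∈ ℬ, star (p A) = p A
  s_partialIsometry : ∀ a : Λ, s a * star (s a) * s a = s a
  p_inter : ∀ A ∈ ℬ, ∀ A' ∈ ℬ, p A * p A' = p (A ∩ A')
  p_union : ∀ A ∈ ℬ, ∀ A' ∈ ℬ, p (A ∪ A') = p A + p A' - p (A ∩ A')
  s_star_s : ∀ a b : Λ, star (s a) * s b = open Classical in if a = b then p (G.range [a]) else 0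

  s_star_p : ∀ a : Λ, ∀ A ∈ ℬ, star (s a) * p A = p (G.relRange A [a]) * star (s a)
  p_sum : ∀ A ∈ ℬ, ∀ hfin : (G.labelSet A).Finite, A ∩ G.sinks = ∅ →
      p A = ∑ a ∈ hfin.toFinset, s a * p (G.relRange A [a]) * star (s a)

namespace LabeledSpaceRep

variable {V : Type u} {E : Type v} {Λ : Type w}
  {G : LabeledGraph V E Λ} {ℬ : Set (Set V)}
  {B : Type*} [CStarAlgebra B]

/-- `s_μ = s_{a₁} ⋯ s_{aₙ}` for a word `μ = a₁ ⋯ aₙ`; `s_ε = 1`. -/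
def sWord (ρ : LabeledSpaceRep G ℬ B) (μ : List Λ) : B := (μ.map ρ.s).prod

end LabeledSpaceRep

namespace LabeledGraph

variable {V : Type u} {E : Type v} {Λ : Type w} {G : LabeledGraph V E Λ}

lemma relRange_mono {A A' : Set V} (h : A ⊆ A') (α : List Λ) :
    G.relRange A α ⊆ G.relRange A' α := by
  rintro v ⟨p, hp, hl, ⟨e, he, hs⟩, hv⟩
  exact ⟨p, hp, hl, ⟨e, he, h hs⟩, hv⟩

lemma relRange_subset_range (A : Set V) (α : List Λ) : G.relRange A α ⊆ G.range α :=
  relRange_mono (Set.subset_univ A) α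

lemma relRange_append (A : Set V) {α β : List Λ} (hα : α ≠ []) (hβ : β ≠ []) :
    G.relRange A (α ++ β) = G.relRange (G.relRange A α) β := by
  ext v
  constructor
  · rintro ⟨p, ⟨-, hc⟩, hl, ⟨e, he, hs⟩, ⟨f, hf, hr⟩⟩
    obtain ⟨p₁, p₂, rfl, rfl, rfl⟩ := List.map_eq_append_iff.1 hl
    have h₁ : p₁ ≠ [] := by simpa using hα
    have h₂ : p₂ ≠ [] := by simpa using hβ
    obtain ⟨hc₁, hc₂, hc⟩ := List.isChain_append.1 hc
    rw [List.head?_append_of_ne_nil _ h₁] at he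
    rw [List.getLast?_append_of_ne_nil _ h₂] at hf
    have hlast := List.getLast?_eq_some_getLast h₁
    have hhead := List.head?_eq_some_head h₂
    exact ⟨p₂, ⟨h₂, hc₂⟩, rfl, ⟨_, hhead, p₁, ⟨h₁, hc₁⟩, rfl, ⟨e, he, hs⟩,
      _, hlast, hc _ hlast _ hhead⟩, f, hf, hr⟩
  · rintro ⟨p₂, ⟨h₂, hc₂⟩, rfl, ⟨g, hg, p₁, ⟨h₁, hc₁⟩, rfl, ⟨e, he, hs⟩, k, hk, hkg⟩, ⟨f, hf, hr⟩⟩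
    refine ⟨p₁ ++ p₂, ⟨by simp [h₁], List.isChain_append.2 ⟨hc₁, hc₂, ?_⟩⟩, by simp,
      ⟨e, by rw [List.head?_append_of_ne_nil _ h₁, he], hs⟩,
      ⟨f, by rw [List.getLast?_append_of_ne_nil _ h₂, hf], hr⟩⟩
    intro x hx y hy
    rw [Option.mem_def, hk, Option.some.injEq] at hx
    rw [Option.mem_def, hg, Option.some.injEq] at hy
    rw [← hx, ← hy, hkg]

lemma singleton_mem_words (a : Λ) : [a] ∈ G.words := by
  obtain ⟨e, rfl⟩ := G.lab_surj a
  exact ⟨[e], ⟨by simp, List.isChain_singleton e⟩, rfl⟩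

lemma left_mem_words {α β : List Λ} (h : α ++ β ∈ G.words) (hα : α ≠ []) : α ∈ G.words := by
  obtain ⟨p, ⟨-, hc⟩, hl⟩ := h
  obtain ⟨p₁, p₂, rfl, rfl, rfl⟩ := List.map_eq_append_iff.1 hl
  exact ⟨p₁, ⟨by simpa using hα, (List.isChain_append.1 hc).1⟩, rfl⟩

lemma right_mem_words {α β : List Λ} (h : α ++ β ∈ G.words) (hβ : β ≠ []) : β ∈ G.words := by
  obtain ⟨p, ⟨-, hc⟩, hl⟩ := h
  obtain ⟨p₁, p₂, rfl, rfl, rfl⟩ := List.map_eq_append_iff.1 hl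
  exact ⟨p₂, ⟨by simpa using hβ, (List.isChain_append.1 hc).2.1⟩, rfl⟩

lemma ne_nil_of_mem_words {α : List Λ} (h : α ∈ G.words) : α ≠ [] := by
  obtain ⟨p, ⟨hp, -⟩, rfl⟩ := h
  simpa using hp

lemma mem_words_of_mem_wordsHash {α : List Λ} (h : α ∈ G.wordsHash) (hα : α ≠ []) :
    α ∈ G.words :=
  h.resolve_left hα

end LabeledGraph

lemma List.exists_eq_append_cons_of_not_prefix {Λ : Type*} {β μ : List Λ}
    (h₁ : ¬ β <+: μ) (h₂ : ¬ μ <+: β) :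
    ∃ (c : List Λ) (a b : Λ) (β' μ' : List Λ),
      a ≠ b ∧ β = c ++ a :: β' ∧ μ = c ++ b :: μ' := by
  induction β generalizing μ with
  | nil => simp at h₁
  | cons a β ih =>
    cases μ with
    | nil => simp at h₂
    | cons b μ =>
      by_cases hab : a = b
      · subst hab
        rw [List.prefix_cons_inj] at h₁ h₂
        obtain ⟨c, x, y, β', μ', hxy, rfl, rfl⟩ := ih h₁ h₂
        exact ⟨a :: c, x, y, β', μ', hxy, rfl, rfl⟩
      · exact ⟨[], a, b, β, μ, hab, rfl, rfl⟩

namespace LabeledSpaceRep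

open LabeledGraph

variable {V : Type u} {E : Type v} {Λ : Type w} {G : LabeledGraph V E Λ} {ℬ : Set (Set V)}
  {B : Type*} [CStarAlgebra B] (ρ : LabeledSpaceRep G ℬ B)

@[simp]
lemma sWord_nil : ρ.sWord [] = 1 := rfl

@[simp]
lemma sWord_singleton (a : Λ) : ρ.sWord [a] = ρ.s a := by simp [sWord]

lemma sWord_cons (a : Λ) (α : List Λ) : ρ.sWord (a :: α) = ρ.s a * ρ.sWord α := by
  simp [sWord]

lemma sWord_append (α β : List Λ) : ρ.sWord (α ++ β) = ρ.sWord α * ρ.sWord β := by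
  simp [sWord]

lemma star_sWord_mul_p (hacc : G.Accommodating ℬ) {γ : List Λ} (hγ : γ ∈ G.words)
    {A : Set V} (hA : A ∈ ℬ) :
    star (ρ.sWord γ) * ρ.p A = ρ.p (G.relRange A γ) * star (ρ.sWord γ) := by
  induction γ generalizing A with
  | nil => exact absurd rfl (ne_nil_of_mem_words hγ)
  | cons a γ ih =>
    by_cases h : γ = []
    · subst h
      simpa using ρ.s_star_p a A hA
    · have hγ' : γ ∈ G.words := right_mem_words (α := [a]) hγ h
      have hr := relRange_append (G := G) A (List.cons_ne_nil a []) h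
      rw [List.singleton_append] at hr
      rw [sWord_cons, star_mul, mul_assoc, ρ.s_star_p a A hA, ← mul_assoc,
        ih hγ' (hacc.relRange_mem A hA _ (singleton_mem_words a)), mul_assoc, hr]

lemma star_sWord_mul_self (hacc : G.Accommodating ℬ) {μ : List Λ} (hμ : μ ∈ G.words) :
    star (ρ.sWord μ) * ρ.sWord μ = ρ.p (G.range μ) := by
  induction μ using List.reverseRecOn with
  | nil => exact absurd rfl (ne_nil_of_mem_words hμ)
  | append_singleton l a ih =>
    by_cases h : l = []
    · subst h
      simpa using ρ.s_star_s a a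
    · have hl := left_mem_words hμ h
      have hr : G.range (l ++ [a]) = G.relRange (G.range l) [a] :=
        relRange_append Set.univ h (List.cons_ne_nil a [])
      have hlB := hacc.range_mem l hl
      have ha := singleton_mem_words (G := G) a
      rw [sWord_append, star_mul, sWord_singleton, mul_assoc, ← mul_assoc (star (ρ.sWord l)),
        ih hl, ← mul_assoc, ρ.s_star_p a _ hlB, mul_assoc, ρ.s_star_s, if_pos rfl,
        ρ.p_inter _ (hacc.relRange_mem _ hlB _ ha) _ (hacc.range_mem _ ha), hr,
        Set.inter_eq_self_of_subset_left (relRange_subset_range _ _)]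

lemma star_sWord_mul_sWord_eq_zero (hacc : G.Accommodating ℬ) {β μ : List Λ}
    (hβ : β ∈ G.wordsHash) (h₁ : ¬ β <+: μ) (h₂ : ¬ μ <+: β) :
    star (ρ.sWord β) * ρ.sWord μ = 0 := by
  obtain ⟨c, a, b, β', μ', hab, rfl, rfl⟩ := List.exists_eq_append_cons_of_not_prefix h₁ h₂
  have hzero : star (ρ.s a) * (star (ρ.sWord c) * ρ.sWord c) * ρ.s b = 0 := by
    have hs : star (ρ.s a) * ρ.s b = 0 := by rw [ρ.s_star_s, if_neg hab]
    by_cases hc : c = []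
    · subst hc
      simpa using hs
    · have hcw := left_mem_words (mem_words_of_mem_wordsHash hβ (by simp)) hc
      rw [ρ.star_sWord_mul_self hacc hcw, ρ.s_star_p a _ (hacc.range_mem c hcw), mul_assoc, hs,
        mul_zero]
  calc star (ρ.sWord (c ++ a :: β')) * ρ.sWord (c ++ b :: μ')
      = star (ρ.sWord β') * (star (ρ.s a) * (star (ρ.sWord c) * ρ.sWord c) * ρ.s b)
          * ρ.sWord μ' := by
        simp only [sWord_append, sWord_cons, star_mul, mul_assoc]
    _ = 0 := by rw [hzero, mul_zero, zero_mul]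

/-- Holds for `μ = ε` as well, where `r(γ)` contains `r(A', γ)`. -/
lemma star_sWord_append_mul_sWord_mul_p (hacc : G.Accommodating ℬ)
    (hwlr : G.WeaklyLeftResolving ℬ) {μ γ : List Λ} (hμ : μ ∈ G.wordsHash) (hγ : γ ∈ G.words)
    {A' : Set V} (hA' : A' ∈ ℬ) :
    star (ρ.sWord (μ ++ γ)) * ρ.sWord μ * ρ.p A' =
      ρ.p (G.range (μ ++ γ) ∩ G.relRange A' γ) * star (ρ.sWord γ) := by
  by_cases h : μ = []
  · subst h
    rw [List.nil_append, sWord_nil, mul_one, ρ.star_sWord_mul_p hacc hγ hA',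
      Set.inter_eq_self_of_subset_right (relRange_subset_range _ _)]
  · have hμw := mem_words_of_mem_wordsHash hμ h
    have hr := hacc.range_mem μ hμw
    rw [sWord_append, star_mul, mul_assoc (star (ρ.sWord γ)), ρ.star_sWord_mul_self hacc hμw,
      mul_assoc, ρ.p_inter _ hr _ hA',
      ρ.star_sWord_mul_p hacc hγ (hacc.inter_mem _ hr _ hA'), hwlr _ hr _ hA' _ hγ, range, range,
      relRange_append _ h (ne_nil_of_mem_words hγ)]

end LabeledSpaceRep

theorem stmt9 {V : Type u} {E : Type v} {Λ : Type w}
    (G : LabeledGraph V E Λ) (ℬ : Set (Set V))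
    (hacc : G.Accommodating ℬ) (hwlr : G.WeaklyLeftResolving ℬ)
    {B : Type*} [CStarAlgebra B] (ρ : LabeledSpaceRep G ℬ B)
    (α β μ ν : List Λ) (hα : α ∈ G.wordsHash) (hβ : β ∈ G.wordsHash)
    (hμ : μ ∈ G.wordsHash) (hν : ν ∈ G.wordsHash)
    (A A' : Set V) (hA : A ∈ ℬ) (hA' : A' ∈ ℬ) :
    (∀ γ ∈ G.words, β = μ ++ γ →
      (ρ.sWord α * ρ.p A * star (ρ.sWord β)) * (ρ.sWord μ * ρ.p A' * star (ρ.sWord ν)) =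
        ρ.sWord α * ρ.p (A ∩ G.range β ∩ G.relRange A' γ) * star (ρ.sWord (ν ++ γ))) ∧
    (β = μ → β ≠ [] →
      (ρ.sWord α * ρ.p A * star (ρ.sWord β)) * (ρ.sWord μ * ρ.p A' * star (ρ.sWord ν)) =
        ρ.sWord α * ρ.p (A ∩ G.range β ∩ A') * star (ρ.sWord ν)) ∧
    (β = [] → μ = [] →
      (ρ.sWord α * ρ.p A * star (ρ.sWord β)) * (ρ.sWord μ * ρ.p A' * star (ρ.sWord ν)) =
        ρ.sWord α * ρ.p (A ∩ A') * star (ρ.sWord ν)) ∧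
    (¬ β <+: μ → ¬ μ <+: β →
      (ρ.sWord α * ρ.p A * star (ρ.sWord β)) * (ρ.sWord μ * ρ.p A' * star (ρ.sWord ν)) = 0) := by
  refine ⟨?_, ?_, ?_, ?_⟩
  · rintro γ hγ rfl
    have hβ' := LabeledGraph.mem_words_of_mem_wordsHash hβ
      (List.append_ne_nil_of_right_ne_nil μ (LabeledGraph.ne_nil_of_mem_words hγ))
    have hmem := hacc.inter_mem _ (hacc.range_mem _ hβ') _ (hacc.relRange_mem _ hA' _ hγ)
    calc _ = ρ.sWord α * ρ.p A * (star (ρ.sWord (μ ++ γ)) * ρ.sWord μ * ρ.p A') *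
            star (ρ.sWord ν) := by simp only [mul_assoc]
      _ = ρ.sWord α * (ρ.p A * ρ.p (G.range (μ ++ γ) ∩ G.relRange A' γ)) *
            (star (ρ.sWord γ) * star (ρ.sWord ν)) := by
        rw [ρ.star_sWord_append_mul_sWord_mul_p hacc hwlr hμ hγ hA']
        simp only [mul_assoc]
      _ = _ := by
        rw [ρ.p_inter _ hA _ hmem, ρ.sWord_append, star_mul, Set.inter_assoc]
  · rintro rfl hne
    have hβ' := LabeledGraph.mem_words_of_mem_wordsHash hβ hne
    have hr := hacc.range_mem _ hβ'
    calc _ = ρ.sWord α * (ρ.p A * (star (ρ.sWord β) * ρ.sWord β) * ρ.p A') *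
            star (ρ.sWord ν) := by simp only [mul_assoc]
      _ = _ := by
        rw [ρ.star_sWord_mul_self hacc hβ', ρ.p_inter _ hA _ hr,
          ρ.p_inter _ (hacc.inter_mem _ hA _ hr) _ hA']
  · rintro rfl rfl
    calc _ = ρ.sWord α * (ρ.p A * ρ.p A') * star (ρ.sWord ν) := by
            simp [mul_assoc]
      _ = _ := by rw [ρ.p_inter _ hA _ hA']
  · intro h₁ h₂
    calc _ = ρ.sWord α * ρ.p A * (star (ρ.sWord β) * ρ.sWord μ) *
            (ρ.p A' * star (ρ.sWord ν)) := by simp only [mul_assoc]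
      _ = 0 := by
        rw [ρ.star_sWord_mul_sWord_eq_zero hacc hβ h₁ h₂, mul_zero, zero_mul]
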